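/- Let λ be a partition with |λ| = k. Then for every natural number n, the sum of wt(T) over all oscillating tableaux T of shape λ and length k+2n equals (n/3 + k/2)·(2n+k+1) times the number of oscillating tableaux of shape λ and length k+2n. Equivalently, the average of |λ^i| over all indices 0 ≤ i ≤ k+2n and all oscillating tableaux (λ⁰,…,λ^{k+2n}) of shape λ and length k+2n is n/3 + k/2. -/

import Mathlib

/-- `ν` covers `μ` in Young's lattice: the Young diagram of `ν` is obtained from that of `μ`
by adding one box. -/
def YCov (μ ν : YoungDiagram) : Prop := μ ≤ ν ∧ ν.card = μ.card + 1

/-- `T` is an oscillating tableau of shape `lam` and length `l`: a sequence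
`(λ⁰, λ¹, …, λˡ)` of partitions with `λ⁰ = ∅`, `λˡ = lam`, and consecutive terms
differing by adding or removing a single box. -/
def IsOscTab (lam : YoungDiagram) (l : ℕ) (T : Fin (l + 1) → YoungDiagram) : Prop :=
  T 0 = ⊥ ∧ T (Fin.last l) = lam ∧
    ∀ i : Fin l, YCov (T i.castSucc) (T i.succ) ∨ YCov (T i.succ) (T i.castSucc)

/-- The set `OT(lam, l)` of oscillating tableaux of shape `lam` and length `l`. -/
def OscTab (lam : YoungDiagram) (l : ℕ) := {T : Fin (l + 1) → YoungDiagram // IsOscTab lam l T}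

/-- The weight of an oscillating tableau: the sum of the sizes of all partitions it visits. -/
def oscWt {lam : YoungDiagram} {l : ℕ} (T : OscTab lam l) : ℕ := ∑ i, (T.1 i).card

namespace YoungDiagram

theorem yCov_iff_exists_insert {μ ν : YoungDiagram} :
    YCov μ ν ↔ ∃ c ∉ μ, ν.cells = insert c μ.cells := by
  constructor
  · rintro ⟨hle, hcard⟩
    obtain ⟨c, hc, h⟩ := (Finset.covBy_iff_exists_insert (s := μ.cells) (t := ν.cells)).1
      (Finset.covBy_iff_card_sdiff_eq_one.2 ⟨cells_subset_iff.2 hle, by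
        rw [Finset.card_sdiff_of_subset (cells_subset_iff.2 hle)]
        exact Nat.sub_eq_of_eq_add' hcard⟩)
    exact ⟨c, hc, h.symm⟩
  · rintro ⟨c, hc, h⟩
    refine ⟨cells_subset_iff.1 (h ▸ Finset.subset_insert c _), ?_⟩
    rw [YoungDiagram.card, h, Finset.card_insert_of_notMem (by simpa using hc)]

/-- The rows of `μ` whose last box can be removed. -/
def removableRows (μ : YoungDiagram) : Set ℕ := {i | μ.rowLen (i + 1) < μ.rowLen i}

/-- The rows of `μ` to which a box can be added. -/
def addableRows (μ : YoungDiagram) : Set ℕ := {i | ∀ i' < i, μ.rowLen i < μ.rowLen i'}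

theorem finite_removableRows (μ : YoungDiagram) : μ.removableRows.Finite := by
  refine (Set.finite_lt_nat (μ.colLen 0)).subset fun i hi => ?_
  rw [Set.mem_ofPred_eq, ← mem_iff_lt_colLen, mem_iff_lt_rowLen]
  exact (Nat.zero_le _).trans_lt hi

theorem addableRows_eq (μ : YoungDiagram) :
    μ.addableRows = insert 0 (Nat.succ '' μ.removableRows) := by
  ext i
  rcases i with _ | i
  · simp [addableRows]
  · simp only [addableRows, removableRows, Set.mem_ofPred_eq, Set.mem_insert_iff, Set.mem_image,
      Nat.succ_eq_add_one, Nat.add_right_cancel_iff, exists_eq_right]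
    refine ⟨fun h => Or.inr (h i (by omega)), fun h i' hi' => ?_⟩
    exact (h.resolve_left (by omega)).trans_le (μ.rowLen_anti i' i (by omega))

/-- The diagram obtained by adding a box at the end of row `i`, where possible. -/
noncomputable def addBox (μ : YoungDiagram) (i : ℕ) : YoungDiagram :=
  open Classical in
  if h : i ∈ μ.addableRows then
    { cells := insert (i, μ.rowLen i) μ.cells
      isLowerSet := by
        rintro ⟨a, b⟩ ⟨a', b'⟩ ⟨hle₁, hle₂⟩ hab
        simp only [Finset.coe_insert, Set.mem_insert_iff, Prod.mk.injEq, Finset.mem_coe,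
          mem_cells] at hab ⊢
        rcases hab with ⟨rfl, rfl⟩ | hab
        · rcases (show a' ≤ a from hle₁).lt_or_eq with hlt | rfl
          · exact Or.inr (mem_iff_lt_rowLen.2 ((show b' ≤ _ from hle₂).trans_lt (h a' hlt)))
          · rcases (show b' ≤ _ from hle₂).lt_or_eq with hlt | rfl
            · exact Or.inr (mem_iff_lt_rowLen.2 hlt)
            · exact Or.inl ⟨rfl, rfl⟩
        · exact Or.inr (μ.up_left_mem hle₁ hle₂ hab) }
  else μ

/-- The diagram obtained by removing the last box of row `i`, where possible. -/
noncomputable def removeBox (μ : YoungDiagram) (i : ℕ) : YoungDiagram :=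
  open Classical in
  if h : i ∈ μ.removableRows then
    { cells := μ.cells.erase (i, μ.rowLen i - 1)
      isLowerSet := by
        rintro ⟨a, b⟩ ⟨a', b'⟩ ⟨hle₁, hle₂⟩ hab
        simp only [Finset.coe_erase, Set.mem_sdiff, Finset.mem_coe, mem_cells,
          Set.mem_singleton_iff, Prod.mk.injEq] at hab ⊢
        refine ⟨μ.up_left_mem hle₁ hle₂ hab.1, ?_⟩
        rintro ⟨rfl, rfl⟩
        have hmem := mem_iff_lt_rowLen.1 hab.1
        have hlt : μ.rowLen (a' + 1) < μ.rowLen a' := h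
        have hle₁ : a' ≤ a := hle₁
        have hle₂ : μ.rowLen a' - 1 ≤ b := hle₂
        rcases hle₁.lt_or_eq with hlt' | rfl
        · have := μ.rowLen_anti (a' + 1) a hlt'
          omega
        · exact hab.2 ⟨rfl, by omega⟩ }
  else μ

theorem cells_addBox {μ : YoungDiagram} {i : ℕ} (h : i ∈ μ.addableRows) :
    (μ.addBox i).cells = insert (i, μ.rowLen i) μ.cells := by
  rw [addBox, dif_pos h]

theorem cells_removeBox {μ : YoungDiagram} {i : ℕ} (h : i ∈ μ.removableRows) :
    (μ.removeBox i).cells = μ.cells.erase (i, μ.rowLen i - 1) := by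
  rw [removeBox, dif_pos h]

theorem setOf_yCov_right (μ : YoungDiagram) : {ν | YCov μ ν} = μ.addBox '' μ.addableRows := by
  ext ν
  rw [Set.mem_ofPred_eq, yCov_iff_exists_insert]
  constructor
  · rintro ⟨⟨i, j⟩, hc, h⟩
    have hmem (a b : ℕ) : (a, b) ∈ ν ↔ (a = i ∧ b = j) ∨ b < μ.rowLen a := by
      rw [← mem_cells, h, Finset.mem_insert, mem_cells, mem_iff_lt_rowLen, Prod.mk.injEq]
    rw [mem_iff_lt_rowLen, not_lt] at hc
    have hij : (i, j) ∈ ν := (hmem i j).2 (Or.inl ⟨rfl, rfl⟩)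
    have hj : j = μ.rowLen i := by
      have := (hmem _ _).1 (ν.up_left_mem le_rfl hc hij)
      omega
    have hi : i ∈ μ.addableRows := fun i' hi' => by
      have := (hmem _ _).1 (ν.up_left_mem hi'.le le_rfl hij)
      omega
    exact ⟨i, hi, YoungDiagram.ext (by rw [cells_addBox hi, h, hj])⟩
  · rintro ⟨i, hi, rfl⟩
    exact ⟨_, by simp [mem_iff_lt_rowLen], cells_addBox hi⟩

theorem setOf_yCov_left (μ : YoungDiagram) :
    {κ | YCov κ μ} = μ.removeBox '' μ.removableRows := by
  ext κ
  rw [Set.mem_ofPred_eq, yCov_iff_exists_insert]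
  constructor
  · rintro ⟨⟨i, j⟩, hc, h⟩
    have hmem (a b : ℕ) : b < μ.rowLen a ↔ (a = i ∧ b = j) ∨ (a, b) ∈ κ := by
      rw [← mem_iff_lt_rowLen, ← mem_cells, h, Finset.mem_insert, mem_cells, Prod.mk.injEq]
    have hij : j < μ.rowLen i := (hmem i j).2 (Or.inl ⟨rfl, rfl⟩)
    have hj : j = μ.rowLen i - 1 := by
      by_contra hne
      have := (hmem i (j + 1)).1 (by omega)
      exact hc (κ.up_left_mem le_rfl (Nat.le_succ j) (this.resolve_left (by omega)))
    have hi : i ∈ μ.removableRows := by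
      by_contra hn
      have := (hmem (i + 1) j).1 (hij.trans_le (not_lt.1 hn))
      exact hc (κ.up_left_mem (Nat.le_succ i) le_rfl (this.resolve_left (by omega)))
    refine ⟨i, hi, YoungDiagram.ext ?_⟩
    rw [cells_removeBox hi, h, ← hj, Finset.erase_insert (by simpa using hc)]
  · rintro ⟨i, hi, rfl⟩
    refine ⟨(i, μ.rowLen i - 1), ?_, ?_⟩
    · rw [← mem_cells, cells_removeBox hi]
      exact Finset.notMem_erase _ _
    · rw [cells_removeBox hi, Finset.insert_erase]
      rw [mem_cells, mem_iff_lt_rowLen]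
      exact Nat.sub_lt ((Nat.zero_le _).trans_lt hi) one_pos

theorem injOn_addBox (μ : YoungDiagram) : Set.InjOn μ.addBox μ.addableRows := by
  intro i hi i' hi' h
  have hmem : (i, μ.rowLen i) ∈ (μ.addBox i').cells := by
    rw [← h, cells_addBox hi]
    exact Finset.mem_insert_self _ _
  rw [cells_addBox hi', Finset.mem_insert, mem_cells, mem_iff_lt_rowLen, Prod.mk.injEq] at hmem
  omega

theorem injOn_removeBox (μ : YoungDiagram) : Set.InjOn μ.removeBox μ.removableRows := by
  intro i hi i' hi' h
  by_contra hne
  have hmem : (i, μ.rowLen i - 1) ∉ (μ.removeBox i').cells := by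
    rw [← h, cells_removeBox hi]
    exact Finset.notMem_erase _ _
  have hi : μ.rowLen (i + 1) < μ.rowLen i := hi
  rw [cells_removeBox hi', Finset.mem_erase, mem_cells, mem_iff_lt_rowLen, ne_eq,
    Prod.mk.injEq] at hmem
  omega

theorem finite_setOf_yCov_right (μ : YoungDiagram) : {ν | YCov μ ν}.Finite := by
  rw [setOf_yCov_right, addableRows_eq]
  exact ((μ.finite_removableRows.image _).insert 0).image _

theorem finite_setOf_yCov_left (μ : YoungDiagram) : {κ | YCov κ μ}.Finite := by
  rw [setOf_yCov_left]
  exact μ.finite_removableRows.image _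

/-- The diagrams covering `μ`. -/
noncomputable def upCovers (μ : YoungDiagram) : Finset YoungDiagram :=
  μ.finite_setOf_yCov_right.toFinset

/-- The diagrams covered by `μ`. -/
noncomputable def downCovers (μ : YoungDiagram) : Finset YoungDiagram :=
  μ.finite_setOf_yCov_left.toFinset

@[simp]
theorem mem_upCovers {μ ν : YoungDiagram} : ν ∈ μ.upCovers ↔ YCov μ ν := by simp [upCovers]

@[simp]
theorem mem_downCovers {μ κ : YoungDiagram} : κ ∈ μ.downCovers ↔ YCov κ μ := by simp [downCovers]

theorem card_upCovers (μ : YoungDiagram) : μ.upCovers.card = μ.downCovers.card + 1 := by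
  rw [upCovers, downCovers, ← Set.ncard_eq_toFinset_card _ μ.finite_setOf_yCov_right,
    ← Set.ncard_eq_toFinset_card _ μ.finite_setOf_yCov_left, setOf_yCov_right, setOf_yCov_left,
    μ.injOn_addBox.ncard_image, μ.injOn_removeBox.ncard_image, addableRows_eq,
    Set.ncard_insert_of_notMem (by simp) (μ.finite_removableRows.image _),
    Set.ncard_image_of_injective _ Nat.succ_injective]

theorem card_sup_add_card_inf (μ ν : YoungDiagram) :
    (μ ⊔ ν).card + (μ ⊓ ν).card = μ.card + ν.card :=
  Finset.card_union_add_card_inter _ _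

theorem eq_of_le_of_card_le {μ ν : YoungDiagram} (h : μ ≤ ν) (hc : ν.card ≤ μ.card) : μ = ν :=
  YoungDiagram.ext (Finset.eq_of_subset_of_card_le (cells_subset_iff.2 h) hc)

/-- Distinct diagrams with a common upper cover are covered by their union and cover their
intersection. -/
theorem sup_eq_and_yCov_inf {μ ρ ν : YoungDiagram} (hμ : YCov μ ν) (hρ : YCov ρ ν) (hne : ρ ≠ μ) :
    μ ⊔ ρ = ν ∧ YCov (μ ⊓ ρ) μ ∧ YCov (μ ⊓ ρ) ρ := by
  have hcard := card_sup_add_card_inf μ ρ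
  have hsup : μ ⊔ ρ = ν := by
    refine eq_of_le_of_card_le (sup_le hμ.1 hρ.1) ?_
    by_contra! hlt
    have := eq_of_le_of_card_le (le_sup_left : μ ≤ μ ⊔ ρ) (by have := hμ.2; omega)
    have := eq_of_le_of_card_le (this ▸ le_sup_right : ρ ≤ μ) (by have := hμ.2; have := hρ.2; omega)
    exact hne this
  rw [hsup] at hcard
  have := hμ.2
  have := hρ.2
  exact ⟨hsup, ⟨inf_le_left, by omega⟩, ⟨inf_le_right, by omega⟩⟩

/-- Distinct diagrams with a common lower cover cover their intersection and are covered by their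
union. -/
theorem inf_eq_and_yCov_sup {μ ρ κ : YoungDiagram} (hμ : YCov κ μ) (hρ : YCov κ ρ) (hne : ρ ≠ μ) :
    μ ⊓ ρ = κ ∧ YCov μ (μ ⊔ ρ) ∧ YCov ρ (μ ⊔ ρ) := by
  have hcard := card_sup_add_card_inf μ ρ
  have hinf : κ = μ ⊓ ρ := by
    refine eq_of_le_of_card_le (le_inf hμ.1 hρ.1) ?_
    by_contra! hlt
    have := eq_of_le_of_card_le (inf_le_left : μ ⊓ ρ ≤ μ) (by have := hμ.2; omega)
    have := eq_of_le_of_card_le (this ▸ inf_le_right : μ ≤ ρ) (by have := hμ.2; have := hρ.2; omega)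
    exact hne this.symm
  rw [← hinf] at hcard
  have := hμ.2
  have := hρ.2
  exact ⟨hinf.symm, ⟨le_sup_left, by omega⟩, ⟨le_sup_right, by omega⟩⟩

/-- The operator sending a function on Young's lattice to its sums over lower covers. -/
noncomputable def upOp : Module.End ℤ (YoungDiagram → ℤ) where
  toFun v μ := ∑ κ ∈ μ.downCovers, v κ
  map_add' v w := funext fun μ => by simp [Finset.sum_add_distrib]
  map_smul' r v := funext fun μ => by simp [Finset.mul_sum]

/-- The operator sending a function on Young's lattice to its sums over upper covers. -/
noncomputable def downOp : Module.End ℤ (YoungDiagram → ℤ) where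
  toFun v μ := ∑ ν ∈ μ.upCovers, v ν
  map_add' v w := funext fun μ => by simp [Finset.sum_add_distrib]
  map_smul' r v := funext fun μ => by simp [Finset.mul_sum]

/-- The operator multiplying a function on Young's lattice by the size. -/
def sizeOp : Module.End ℤ (YoungDiagram → ℤ) where
  toFun v μ := μ.card * v μ
  map_add' v w := funext fun μ => by simp [mul_add]
  map_smul' r v := funext fun μ => by simp [mul_left_comm]

theorem upOp_apply (v : YoungDiagram → ℤ) (μ : YoungDiagram) :
    upOp v μ = ∑ κ ∈ μ.downCovers, v κ := rfl

theorem downOp_apply (v : YoungDiagram → ℤ) (μ : YoungDiagram) :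
    downOp v μ = ∑ ν ∈ μ.upCovers, v ν := rfl

theorem sizeOp_apply (v : YoungDiagram → ℤ) (μ : YoungDiagram) : sizeOp v μ = μ.card * v μ := rfl

/-- Young's lattice is a differential poset. -/
theorem downOp_upOp (v : YoungDiagram → ℤ) : downOp (upOp v) = upOp (downOp v) + v := by
  classical
  funext μ
  have hup : downOp (upOp v) μ
      = ∑ ν ∈ μ.upCovers, ∑ ρ ∈ ν.downCovers.erase μ, v ρ + μ.upCovers.card * v μ := by
    simp only [downOp_apply, upOp_apply]
    rw [← nsmul_eq_mul, ← Finset.sum_const, ← Finset.sum_add_distrib]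
    exact Finset.sum_congr rfl fun ν hν => (Finset.sum_erase_add _ _ (by simpa using hν)).symm
  have hdown : upOp (downOp v) μ
      = ∑ κ ∈ μ.downCovers, ∑ ρ ∈ κ.upCovers.erase μ, v ρ + μ.downCovers.card * v μ := by
    simp only [downOp_apply, upOp_apply]
    rw [← nsmul_eq_mul, ← Finset.sum_const, ← Finset.sum_add_distrib]
    exact Finset.sum_congr rfl fun κ hκ => (Finset.sum_erase_add _ _ (by simpa using hκ)).symm
  have hswap : ∑ ν ∈ μ.upCovers, ∑ ρ ∈ ν.downCovers.erase μ, v ρ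
      = ∑ κ ∈ μ.downCovers, ∑ ρ ∈ κ.upCovers.erase μ, v ρ := by
    rw [Finset.sum_sigma', Finset.sum_sigma']
    refine Finset.sum_bij' (fun p _ => ⟨μ ⊓ p.2, p.2⟩) (fun p _ => ⟨μ ⊔ p.2, p.2⟩) ?_ ?_ ?_ ?_ ?_
    · rintro ⟨ν, ρ⟩ h
      simp only [Finset.mem_sigma, mem_upCovers, mem_downCovers, Finset.mem_erase] at h ⊢
      have := sup_eq_and_yCov_inf h.1 h.2.2 h.2.1
      exact ⟨this.2.1, h.2.1, this.2.2⟩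
    · rintro ⟨κ, ρ⟩ h
      simp only [Finset.mem_sigma, mem_upCovers, mem_downCovers, Finset.mem_erase] at h ⊢
      have := inf_eq_and_yCov_sup h.1 h.2.2 h.2.1
      exact ⟨this.2.1, h.2.1, this.2.2⟩
    · rintro ⟨ν, ρ⟩ h
      simp only [Finset.mem_sigma, mem_upCovers, mem_downCovers, Finset.mem_erase] at h
      simp only [(sup_eq_and_yCov_inf h.1 h.2.2 h.2.1).1]
    · rintro ⟨κ, ρ⟩ h
      simp only [Finset.mem_sigma, mem_upCovers, mem_downCovers, Finset.mem_erase] at h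
      simp only [(inf_eq_and_yCov_sup h.1 h.2.2 h.2.1).1]
    · exact fun _ _ => rfl
  rw [Pi.add_apply, hup, hdown, hswap, card_upCovers]
  push_cast
  ring

theorem sizeOp_upOp (v : YoungDiagram → ℤ) : sizeOp (upOp v) = upOp (sizeOp v) + upOp v := by
  funext μ
  simp only [Pi.add_apply, sizeOp_apply, upOp_apply, Finset.mul_sum, ← Finset.sum_add_distrib]
  refine Finset.sum_congr rfl fun κ hκ => ?_
  rw [(mem_downCovers.1 hκ).2]
  push_cast
  ring

theorem sizeOp_downOp (v : YoungDiagram → ℤ) :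
    sizeOp (downOp v) = downOp (sizeOp v) - downOp v := by
  funext μ
  simp only [Pi.sub_apply, sizeOp_apply, downOp_apply, Finset.mul_sum, ← Finset.sum_sub_distrib]
  refine Finset.sum_congr rfl fun ν hν => ?_
  rw [(mem_upCovers.1 hν).2]
  push_cast
  ring

open Classical in
/-- The oscillating tableaux of shape `lam` and length `l`, as a finset of sequences. -/
noncomputable def oscTabFinset : (l : ℕ) → YoungDiagram → Finset (Fin (l + 1) → YoungDiagram)
  | 0, lam => if lam = ⊥ then {fun _ => ⊥} else ∅
  | l + 1, lam => (lam.downCovers ∪ lam.upCovers).biUnion fun μ =>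
      (oscTabFinset l μ).image fun T => Fin.snoc (α := fun _ => YoungDiagram) T lam

theorem mem_oscTabFinset {l : ℕ} {lam : YoungDiagram} {T : Fin (l + 1) → YoungDiagram} :
    T ∈ oscTabFinset l lam ↔ IsOscTab lam l T := by
  induction l generalizing lam with
  | zero =>
    by_cases h : lam = ⊥
    · simp only [oscTabFinset, h, if_true, Finset.mem_singleton, IsOscTab, IsEmpty.forall_iff,
        and_true, funext_iff, Fin.last_zero, and_self]
      exact Fin.forall_fin_one
    · simp only [oscTabFinset, h, if_false, Finset.notMem_empty, IsOscTab, IsEmpty.forall_iff,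
        and_true, Fin.last_zero, false_iff, not_and]
      rintro h0 rfl
      exact h h0
  | succ l ih =>
    simp only [oscTabFinset, Finset.mem_biUnion, Finset.mem_image, ih, Finset.mem_union,
      mem_upCovers, mem_downCovers]
    constructor
    · rintro ⟨μ, hμ, T, ⟨h0, hl, hT⟩, rfl⟩
      refine ⟨?_, Fin.snoc_last _ _, fun i => ?_⟩
      · rw [← Fin.castSucc_zero, Fin.snoc_castSucc, h0]
      · cases i using Fin.lastCases with
        | last => rw [Fin.succ_last, Fin.snoc_last, Fin.snoc_castSucc, hl]; exact hμ
        | cast i =>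
          rw [Fin.succ_castSucc, Fin.snoc_castSucc, Fin.snoc_castSucc]
          exact hT i
    · rintro ⟨h0, hl, hT⟩
      refine ⟨T (Fin.last l).castSucc, ?_, Fin.init T, ⟨h0, rfl, fun i => ?_⟩, ?_⟩
      · have := hT (Fin.last l)
        rwa [Fin.succ_last, hl] at this
      · exact hT i.castSucc
      · rw [← hl]
        exact Fin.snoc_init_self T

theorem sum_oscTabFinset_succ (l : ℕ) (lam : YoungDiagram)
    (f : (Fin (l + 2) → YoungDiagram) → ℤ) :
    ∑ T ∈ oscTabFinset (l + 1) lam, f T =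
      (∑ μ ∈ lam.downCovers, ∑ T ∈ oscTabFinset l μ, f (Fin.snoc T lam)) +
        ∑ μ ∈ lam.upCovers, ∑ T ∈ oscTabFinset l μ, f (Fin.snoc T lam) := by
  classical
  rw [oscTabFinset, Finset.sum_biUnion, Finset.sum_union]
  · have (μ : YoungDiagram) :
        ∑ T ∈ (oscTabFinset l μ).image (fun T => Fin.snoc (α := fun _ => YoungDiagram) T lam), f T
          = ∑ T ∈ oscTabFinset l μ, f (Fin.snoc T lam) :=
      Finset.sum_image fun T _ T' _ h => (Fin.snoc_injective2 h).1
    simp only [this]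
  · refine Finset.disjoint_left.2 fun μ h h' => ?_
    have := (mem_downCovers.1 h).2
    have := (mem_upCovers.1 h').2
    omega
  · refine fun μ _ μ' _ hne => Finset.disjoint_left.2 fun T h h' => hne ?_
    simp only [Finset.mem_image, mem_oscTabFinset] at h h'
    obtain ⟨S, hS, rfl⟩ := h
    obtain ⟨S', hS', h⟩ := h'
    rw [← hS.2.1, ← hS'.2.1, (Fin.snoc_injective2 h).1]

/-- The number of oscillating tableaux of length `l`, as a function of the shape. -/
noncomputable def oscCount (l : ℕ) (lam : YoungDiagram) : ℤ := ∑ _T ∈ oscTabFinset l lam, 1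

/-- The total weight of the oscillating tableaux of length `l`, as a function of the shape. -/
noncomputable def oscTotalWt (l : ℕ) (lam : YoungDiagram) : ℤ :=
  ∑ T ∈ oscTabFinset l lam, ∑ i, ((T i).card : ℤ)

theorem oscCount_succ (l : ℕ) : oscCount (l + 1) = upOp (oscCount l) + downOp (oscCount l) :=
  funext fun lam => sum_oscTabFinset_succ l lam _

theorem oscTotalWt_succ (l : ℕ) : oscTotalWt (l + 1) =
    upOp (oscTotalWt l) + downOp (oscTotalWt l) + sizeOp (oscCount (l + 1)) := by
  funext lam
  rw [oscTotalWt, sum_oscTabFinset_succ, oscCount_succ]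
  simp only [Pi.add_apply, sizeOp_apply, upOp_apply, downOp_apply, oscTotalWt, oscCount,
    Fin.sum_univ_castSucc (n := l + 1), Fin.snoc_castSucc, Fin.snoc_last, Finset.sum_add_distrib,
    mul_add, Finset.mul_sum, mul_one]
  ring

theorem oscCount_zero_of_ne {lam : YoungDiagram} (h : lam ≠ ⊥) : oscCount 0 lam = 0 := by
  simp [oscCount, oscTabFinset, h]

theorem sizeOp_oscCount_zero : sizeOp (oscCount 0) = 0 := by
  funext lam
  by_cases h : lam = ⊥
  · simp [sizeOp_apply, h, YoungDiagram.card]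
  · simp [sizeOp_apply, oscCount_zero_of_ne h]

theorem downOp_oscCount_zero : downOp (oscCount 0) = 0 := by
  funext lam
  refine Finset.sum_eq_zero fun ν hν => oscCount_zero_of_ne ?_
  rintro rfl
  simpa [YoungDiagram.card] using (mem_upCovers.1 hν).2

theorem oscTotalWt_zero : oscTotalWt 0 = 0 := by
  funext lam
  by_cases h : lam = ⊥ <;> simp [oscTotalWt, oscTabFinset, h, YoungDiagram.card]

theorem downOp_oscCount_succ (l : ℕ) : downOp (oscCount (l + 1)) = ((l : ℤ) + 1) • oscCount l := by
  induction l with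
  | zero => rw [oscCount_succ, map_add, downOp_upOp, downOp_oscCount_zero]; simp
  | succ l ih =>
    rw [oscCount_succ, map_add, downOp_upOp, ih, map_smul, map_smul, oscCount_succ l]
    push_cast
    module

theorem sizeOp_oscCount_succ (l : ℕ) :
    sizeOp (oscCount (l + 1)) = ((l : ℤ) + 1) • upOp (oscCount l) := by
  induction l with
  | zero =>
    rw [oscCount_succ, map_add, sizeOp_upOp, downOp_oscCount_zero, sizeOp_oscCount_zero]
    simp
  | succ l ih =>
    rw [oscCount_succ, map_add, sizeOp_upOp, sizeOp_downOp, ih, downOp_oscCount_succ, map_smul,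
      map_smul, downOp_upOp, oscCount_succ, map_add]
    push_cast
    module

theorem oscTotalWt_eq (l : ℕ) : (6 : ℤ) • oscTotalWt l =
    ((l : ℤ) + 1) • ((l : ℤ) • oscCount l + (2 : ℤ) • sizeOp (oscCount l)) := by
  induction l with
  | zero => simp [oscTotalWt_zero, sizeOp_oscCount_zero]
  | succ l ih =>
    have hup := congrArg upOp ih
    have hdown := congrArg downOp ih
    have hsize := sizeOp_oscCount_succ l
    rw [oscCount_succ, map_add, sizeOp_upOp, sizeOp_downOp] at hsize
    simp only [map_add, map_smul] at hup hdown
    rw [oscTotalWt_succ, oscCount_succ, map_add, sizeOp_upOp, sizeOp_downOp]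
    funext lam
    have hup := congrFun hup lam
    have hdown := congrFun hdown lam
    have hsize := congrFun hsize lam
    simp only [Pi.add_apply, Pi.sub_apply, Pi.smul_apply, smul_eq_mul] at hup hdown hsize ⊢
    push_cast
    linear_combination hup + hdown + 4 * hsize

end YoungDiagram

open YoungDiagram in
/-- **Corollary 3.**  If `|λ| = k` then for all `n`, the total weight of all oscillating
tableaux of shape `λ` and length `k + 2n` equals `(n/3 + k/2)·(2n + k + 1)` times their
number; equivalently (clearing the denominator `6`), six times the total weight equals
`(2n + 3k)·(2n + k + 1)` times the number of tableaux, i.e. the average size of a visited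
partition is `n/3 + k/2`. -/
theorem average_size_oscillating_tableaux (lam : YoungDiagram) (k : ℕ) (hk : lam.card = k)
    (n : ℕ) :
    6 * (∑ᶠ T : OscTab lam (k + 2 * n), oscWt T) =
      (2 * n + 3 * k) * (2 * n + k + 1) * Nat.card (OscTab lam (k + 2 * n)) := by
  have hcount : (Nat.card (OscTab lam (k + 2 * n)) : ℤ) = oscCount (k + 2 * n) lam := by
    rw [OscTab, Nat.subtype_card (oscTabFinset (k + 2 * n) lam) fun _ => mem_oscTabFinset]
    simp [oscCount]
  have hwt : ((∑ᶠ T : OscTab lam (k + 2 * n), oscWt T : ℕ) : ℤ) = oscTotalWt (k + 2 * n) lam := by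
    have hset : {T | IsOscTab lam (k + 2 * n) T} = ↑(oscTabFinset (k + 2 * n) lam) :=
      Set.ext fun _ => mem_oscTabFinset.symm
    have hsum : ∑ᶠ T : OscTab lam (k + 2 * n), oscWt T =
        ∑ᶠ T ∈ {T | IsOscTab lam (k + 2 * n) T}, ∑ i, (T i).card :=
      finsum_subtype_eq_finsum_cond (f := fun T : Fin (k + 2 * n + 1) → YoungDiagram =>
        ∑ i, (T i).card) (IsOscTab lam (k + 2 * n))
    rw [hsum, hset, finsum_mem_coe_finset, oscTotalWt]
    push_cast
    rfl
  have h := congrFun (oscTotalWt_eq (k + 2 * n)) lam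
  simp only [Pi.add_apply, Pi.smul_apply, smul_eq_mul, sizeOp_apply, ← hcount, ← hwt, hk] at h
  zify
  rw [h]
  push_cast
  ring
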